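/- arXiv:math/0510098 — 7 statements merged into one kernel-verified Lean document; each statement's English description precedes it below -/
import Mathlib

section
/- Let L be a finite lattice, let N(a/b,c) be a pentagon in L, and let a'/b' be a prime quotient contained in a/b, i.e. b ≤ b' ⋖ a' ≤ a. Then there exists a prime quotient x/y contained in b/0_N, i.e. a ∧ c ≤ y ⋖ x ≤ b, such that (a',b') ∈ θ(x,y), i.e. every lattice congruence on L relating x and y relates a' and b'. -/
/-- A lattice congruence: an equivalence relation compatible with meets and joins. -/
def IsLatCong {α : Type*} [Lattice α] (θ : α → α → Prop) : Prop :=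
  Equivalence θ ∧
    ∀ a b c d : α, θ a b → θ c d → θ (a ⊓ c) (b ⊓ d) ∧ θ (a ⊔ c) (b ⊔ d)

/-- A prime quotient `a'/b'` is collapsed by every congruence relating `x` and `y`, as soon as the
translation `u ↦ ((u ⊔ c) ⊓ a') ⊔ b'` separates `x` from `y`, sending `y` to `b'`. -/
theorem IsLatCong.rel_of_covBy {α : Type*} [Lattice α] {θ : α → α → Prop} (hθ : IsLatCong θ)
    {a' b' c x y : α} (hcov : b' ⋖ a') (hy : (y ⊔ c) ⊓ a' ⊔ b' = b')
    (hx : (x ⊔ c) ⊓ a' ⊔ b' ≠ b') (hxy : θ x y) : θ a' b' := by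
  have hxa : (x ⊔ c) ⊓ a' ⊔ b' = a' :=
    (hcov.eq_or_eq le_sup_right (sup_le inf_le_right hcov.le)).resolve_left hx
  have h := (hθ.2 _ _ _ _ (hθ.2 _ _ _ _ (hθ.2 _ _ _ _ hxy (hθ.1.refl c)).2
    (hθ.1.refl a')).1 (hθ.1.refl b')).2
  rwa [hxa, hy] at h

/-- In a finite lattice, given a pentagon `N(a/b,c)` and a prime
quotient `a'/b' ⊆ a/b`, there is a prime quotient `x/y ⊆ b/(a ⊓ c)` such that
`(a',b') ∈ θ(x,y)`, i.e. every congruence relating `x` and `y` relates `a'` and `b'`. -/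
theorem pentagon_prime_quotient_down {α : Type*} [Lattice α] [Finite α]
    (a b c a' b' : α)
    (hba : b ≤ a) (hjoin : a ⊔ c = b ⊔ c) (hmeet : a ⊓ c = b ⊓ c)
    (hb' : b ≤ b') (hcov : b' ⋖ a') (ha' : a' ≤ a) :
    ∃ x y : α, a ⊓ c ≤ y ∧ y ⋖ x ∧ x ≤ b ∧
      ∀ θ : α → α → Prop, IsLatCong θ → θ x y → θ a' b' := by
  have hbot : (a ⊓ c ⊔ c) ⊓ a' ⊔ b' = b' := by
    rw [sup_eq_right.2 (inf_le_right : a ⊓ c ≤ c), sup_eq_right]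
    calc c ⊓ a' ≤ a ⊓ c := le_inf (inf_le_right.trans ha') inf_le_left
      _ = b ⊓ c := hmeet
      _ ≤ b' := inf_le_left.trans hb'
  have htop : (b ⊔ c) ⊓ a' ⊔ b' = a' := by
    rw [← hjoin, inf_eq_right.2 (ha'.trans le_sup_left), sup_eq_left.2 hcov.le]
  obtain ⟨y, ⟨hy0, hyb, hy⟩, hmax⟩ :=
    (Set.toFinite {y : α | a ⊓ c ≤ y ∧ y ≤ b ∧ (y ⊔ c) ⊓ a' ⊔ b' = b'}).exists_maximal
      ⟨a ⊓ c, le_rfl, hmeet.trans_le inf_le_left, hbot⟩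
  have hne : y ≠ b := by
    rintro rfl
    exact hcov.ne (hy.symm.trans htop)
  obtain ⟨x, hyx, hxb⟩ := exists_covBy_le_of_lt (lt_of_le_of_ne hyb hne)
  refine ⟨x, y, hy0, hyx, hxb, fun θ hθ hxy => hθ.rel_of_covBy hcov hy (fun hx => ?_) hxy⟩
  exact hyx.lt.not_ge (hmax ⟨hy0.trans hyx.le, hxb, hx⟩ hyx.le)
end

section
/- Let L be a finite lattice containing a nondegenerate pentagon N(a/b,c) (b < a, a ∨ c = b ∨ c, a ∧ c = b ∧ c). Then the join dependency relation of L is nonempty: there exist distinct join-irreducible elements j ≠ j' of L, with unique lower covers j_* and j'_*, such that every lattice congruence on L relating j' and j'_* also relates j and j_*. -/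
/-- In a finite lattice, if `a ≰ b` then there is an element `j ≤ a` with `j ≰ b` all of whose
strict lower bounds lie below `b`. -/
theorem exists_le_not_le_forall_lt_le {α : Type*} [Lattice α] [Finite α] {a b : α}
    (h : ¬a ≤ b) : ∃ j ≤ a, ¬j ≤ b ∧ ∀ w < j, w ≤ b := by
  obtain ⟨j, hja, hj⟩ := (Set.toFinite {x : α | x ≤ a ∧ ¬x ≤ b}).exists_le_minimal
    (show a ∈ {x : α | x ≤ a ∧ ¬x ≤ b} from ⟨le_rfl, h⟩)
  refine ⟨j, hja, hj.prop.2, fun w hw => ?_⟩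
  by_contra hwb
  exact hj.not_prop_of_lt hw ⟨hw.le.trans hja, hwb⟩

/-- If `j ≰ b` and every strict lower bound of `j` lies below `b`, then `j ⊓ b` is covered
by `j`. -/
theorem inf_covBy_of_forall_lt_le {α : Type*} [Lattice α] {j b : α}
    (hj : ¬j ≤ b) (h : ∀ w < j, w ≤ b) : j ⊓ b ⋖ j :=
  ⟨inf_lt_left.2 hj, fun _ hx hxj => hx.not_ge (le_inf hxj.le (h _ hxj))⟩

/-- If `j ≰ b` and every strict lower bound of `j` lies below `b`, then `j ⊓ b` is the only
possible lower cover of `j`. -/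
theorem CovBy.eq_inf_of_forall_lt_le {α : Type*} [Lattice α] {j b w : α}
    (hj : ¬j ≤ b) (h : ∀ w < j, w ≤ b) (hw : w ⋖ j) : w = j ⊓ b :=
  (hw.eq_or_eq (le_inf hw.le (h w hw.lt)) inf_le_left).elim Eq.symm
    fun e => absurd (inf_eq_left.1 e) hj

/-- A finite lattice containing a nondegenerate pentagon has nonempty
join dependency relation: there are distinct join-irreducibles `j ≠ j'` (with unique
lower covers `j_*`, `j'_*`) such that every congruence relating `j'` and `j'_*`
relates `j` and `j_*`. -/
theorem pentagon_D_nonempty {α : Type*} [Lattice α] [Finite α] (a b c : α)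
    (hba : b < a) (hjoin : a ⊔ c = b ⊔ c) (hmeet : a ⊓ c = b ⊓ c) :
    ∃ j j' jstar j'star : α, j ≠ j' ∧
      jstar ⋖ j ∧ (∀ w : α, w ⋖ j → w = jstar) ∧
      j'star ⋖ j' ∧ (∀ w : α, w ⋖ j' → w = j'star) ∧
      ∀ θ : α → α → Prop, IsLatCong θ → θ j' j'star → θ j jstar := by
  obtain ⟨j, hja, hjb, hj⟩ := exists_le_not_le_forall_lt_le hba.not_ge
  have hjc : ¬j ≤ c := fun h => hjb ((le_inf hja h).trans (hmeet.le.trans inf_le_left))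
  obtain ⟨m, hbm, hm⟩ := (Set.toFinite {x : α | ¬j ≤ x}).exists_le_maximal
    (show b ∈ {x : α | ¬j ≤ x} from hjb)
  have hjm : ¬j ≤ m := hm.prop
  have hcm : ¬c ≤ m := fun h =>
    hjm (hja.trans (le_sup_left.trans (hjoin.le.trans (sup_le hbm h))))
  obtain ⟨j', hj'c, hj'm, hj'⟩ := exists_le_not_le_forall_lt_le hcm
  have hjle : j ≤ j' ⊔ m := by
    by_contra h
    exact hm.not_prop_of_gt (right_lt_sup.2 hj'm) h
  have hinf : m ⊓ j = j ⊓ b :=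
    le_antisymm (le_inf inf_le_right (hj _ (inf_lt_right.2 hjm)))
      (le_inf (inf_le_right.trans hbm) inf_le_left)
  refine ⟨j, j', j ⊓ b, j' ⊓ m, fun e => hjc (e.le.trans hj'c),
    inf_covBy_of_forall_lt_le hjb hj, fun w hw => hw.eq_inf_of_forall_lt_le hjb hj,
    inf_covBy_of_forall_lt_le hj'm hj', fun w hw => hw.eq_inf_of_forall_lt_le hj'm hj',
    fun θ hθ h => ?_⟩
  have hsup := (hθ.2 _ _ _ _ h (hθ.1.refl m)).2
  have hres := (hθ.2 _ _ _ _ hsup (hθ.1.refl j)).1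
  rwa [inf_eq_right.2 hjle, sup_eq_right.2 inf_le_right, hinf] at hres
end

section
/- A finite lattice L is distributive if and only if both of the following hold: (i) there are no distinct join-irreducible elements j ≠ j' of L, with unique lower covers j_* and j'_*, such that every lattice congruence relating j' and j'_* relates j and j_*; and (ii) there are no distinct meet-irreducible elements m ≠ m' of L, with unique upper covers m^* and m'^*, such that every lattice congruence relating m' and m'^* relates m and m^*. -/
theorem IsLatCong.dual {α : Type*} [Lattice α] {θ : α → α → Prop} (h : IsLatCong θ) :
    IsLatCong (α := αᵒᵈ) (fun a b => θ a.ofDual b.ofDual) :=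
  ⟨⟨fun _ => h.1.refl _, fun hab => h.1.symm hab, fun hab hbc => h.1.trans hab hbc⟩,
    fun _ _ _ _ hab hcd => (h.2 _ _ _ _ hab hcd).symm⟩

/-- In a finite poset, everything strictly below an element with a unique lower cover lies
below that cover. -/
theorem le_of_lt_of_forall_covBy_eq {α : Type*} [PartialOrder α] [Finite α] {j s x : α}
    (hs : ∀ w, w ⋖ j → w = s) (hx : x < j) : x ≤ s := by
  obtain ⟨w, hxw, hw⟩ := exists_le_covBy_of_lt hx
  exact hs w hw ▸ hxw

/-- In a finite distributive lattice, elements with a unique lower cover are join-prime. -/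
theorem le_or_le_of_le_sup_of_forall_covBy_eq {α : Type*} [Lattice α] [Finite α]
    (h : ∀ x y z : α, x ⊓ (y ⊔ z) = (x ⊓ y) ⊔ (x ⊓ z)) {j s a b : α} (hsj : s ⋖ j)
    (hs : ∀ w, w ⋖ j → w = s) (hab : j ≤ a ⊔ b) : j ≤ a ∨ j ≤ b := by
  by_contra! hn
  have below {c : α} (hc : ¬ j ≤ c) : j ⊓ c ≤ s :=
    le_of_lt_of_forall_covBy_eq hs (inf_lt_left.2 hc)
  have hj : j = (j ⊓ a) ⊔ (j ⊓ b) := by rw [← h, inf_eq_left.2 hab]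
  exact hsj.lt.not_ge (hj.le.trans (sup_le (below hn.1) (below hn.2)))

/-- The equivalence relation with classes `Set.Ici j` and its complement is a congruence when
`j` is join-prime. -/
theorem isLatCong_le_iff_le {α : Type*} [Lattice α] {j : α}
    (hj : ∀ a b, j ≤ a ⊔ b → j ≤ a ∨ j ≤ b) : IsLatCong fun x y => (j ≤ x ↔ j ≤ y) := by
  have le_sup_iff' (a b : α) : j ≤ a ⊔ b ↔ j ≤ a ∨ j ≤ b :=
    ⟨hj a b, fun h => h.elim le_sup_of_le_left le_sup_of_le_right⟩
  refine ⟨⟨fun _ => Iff.rfl, Iff.symm, Iff.trans⟩, fun a b c d hab hcd => ⟨?_, ?_⟩⟩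
  · simp only [le_inf_iff, hab, hcd]
  · simp only [le_sup_iff', hab, hcd]

/-- In a finite distributive lattice, distinct join-irreducibles are independent: some congruence
collapses the second one to its lower cover but not the first. -/
theorem exists_isLatCong_separating {α : Type*} [Lattice α] [Finite α]
    (h : ∀ x y z : α, x ⊓ (y ⊔ z) = (x ⊓ y) ⊔ (x ⊓ z)) {j j' s s' : α} (hne : j ≠ j')
    (hsj : s ⋖ j) (hs : ∀ w, w ⋖ j → w = s) (hsj' : s' ⋖ j') (hs' : ∀ w, w ⋖ j' → w = s') :
    ∃ θ : α → α → Prop, IsLatCong θ ∧ θ j' s' ∧ ¬ θ j s :=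
  ⟨fun x y => (j ≤ x ↔ j ≤ y),
    isLatCong_le_iff_le fun _ _ => le_or_le_of_le_sup_of_forall_covBy_eq h hsj hs,
    ⟨fun hle => le_of_lt_of_forall_covBy_eq hs' (hle.lt_of_ne hne), fun hle => hle.trans hsj'.le⟩,
    fun hiff => hsj.lt.not_ge (hiff.1 le_rfl)⟩

/-- A congruence collapsing `k` to `t` collapses `j` to its unique lower cover, whenever
`j ≤ k ⊔ p` but `j ≰ t ⊔ p`. -/
theorem IsLatCong.rel_of_le_sup {α : Type*} [Lattice α] [Finite α] {θ : α → α → Prop}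
    (hθ : IsLatCong θ) {j s k t p : α} (hsj : s ⋖ j) (hs : ∀ w, w ⋖ j → w = s) (hkt : θ k t)
    (hk : j ≤ k ⊔ p) (ht : ¬ j ≤ t ⊔ p) : θ j s := by
  have hrefl (x : α) : θ x x := hθ.1.refl x
  have hsup := (hθ.2 _ _ _ _ hkt (hrefl p)).2
  have hinf := (hθ.2 _ _ _ _ (hrefl j) hsup).1
  rw [inf_eq_left.2 hk] at hinf
  have hle : j ⊓ (t ⊔ p) ≤ s := le_of_lt_of_forall_covBy_eq hs (inf_lt_left.2 ht)
  have := (hθ.2 _ _ _ _ hinf (hrefl s)).2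
  rwa [sup_eq_left.2 hsj.le, sup_eq_right.2 hle] at this

/-- An element minimal among those not below `v` has `w ⊓ v` as its unique lower cover. -/
theorem covBy_iff_eq_inf_of_forall_lt_le {α : Type*} [Lattice α] {w v : α} (hwv : ¬ w ≤ v)
    (hmin : ∀ x, x < w → x ≤ v) (x : α) : x ⋖ w ↔ x = w ⊓ v := by
  have hlt : w ⊓ v < w := inf_lt_left.2 hwv
  have hle {y : α} (hy : y < w) : y ≤ w ⊓ v := le_inf hy.le (hmin y hy)
  constructor
  · intro hx
    exact (hx.eq_or_eq (hle hx.lt) hlt.le).elim Eq.symm fun h => absurd h hlt.ne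
  · rintro rfl
    exact ⟨hlt, fun y hy hyw => hy.not_ge (hle hyw)⟩

/-- In a finite lattice, a non-minimal element either has a unique lower cover or is the join
of two strictly smaller elements. -/
theorem exists_unique_covBy_or_eq_sup {α : Type*} [Lattice α] [Finite α] {a b : α} (hb : b < a) :
    (∃ t, t ⋖ a ∧ ∀ w, w ⋖ a → w = t) ∨ ∃ x y, x < a ∧ y < a ∧ x ⊔ y = a := by
  obtain ⟨t, -, ht⟩ := exists_le_covBy_of_lt hb
  by_cases h : ∀ w, w ⋖ a → w = t
  · exact Or.inl ⟨t, ht, h⟩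
  · push Not at h
    obtain ⟨w, hw, hne⟩ := h
    exact Or.inr ⟨w, t, hw.lt, ht.lt, hw.wcovBy.sup_eq ht.wcovBy hne⟩

/-- If `j` depends on no other join-irreducible, then `j` is join-prime. -/
theorem le_or_le_of_le_sup_of_not_depends {α : Type*} [Lattice α] [Finite α] {j a b : α}
    (h : ∀ k t p, j ≠ k → t ⋖ k → (∀ w, w ⋖ k → w = t) → j ≤ k ⊔ p → j ≤ t ⊔ p)
    (hab : j ≤ a ⊔ b) : j ≤ a ∨ j ≤ b := by
  induction a using WellFoundedLT.induction generalizing b with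
  | ind a ih =>
    by_contra! hn
    have hlt : a ⊓ b < a := inf_lt_left.2 fun hle => hn.2 (sup_eq_right.2 hle ▸ hab)
    have not_le {x c : α} (hx : x < a) (hc : ¬ j ≤ c) : ¬ j ≤ x ⊔ c := fun hle =>
      (ih x hx hle).elim (fun hjx => hn.1 (hjx.trans hx.le)) hc
    rcases exists_unique_covBy_or_eq_sup hlt with ⟨t, hta, ht⟩ | ⟨x, y, hx, hy, rfl⟩
    · exact not_le hta.lt hn.2 (h a t b (fun he => hn.1 he.le) hta ht hab)
    · exact not_le hx (not_le hy hn.2) (sup_assoc x y b ▸ hab)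

/-- A finite lattice in which the elements with a unique lower cover are join-prime is
distributive. -/
theorem inf_sup_left_of_forall_le_or_le {α : Type*} [Lattice α] [Finite α]
    (h : ∀ j s : α, s ⋖ j → (∀ w, w ⋖ j → w = s) → ∀ a b, j ≤ a ⊔ b → j ≤ a ∨ j ≤ b)
    (x y z : α) : x ⊓ (y ⊔ z) = (x ⊓ y) ⊔ (x ⊓ z) := by
  refine le_antisymm ?_ le_inf_sup
  suffices ∀ w, w ≤ x ⊓ (y ⊔ z) → w ≤ (x ⊓ y) ⊔ (x ⊓ z) from this _ le_rfl
  intro w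
  induction w using WellFoundedLT.induction with
  | ind w ih =>
    intro hw
    by_contra hn
    have hcov := covBy_iff_eq_inf_of_forall_lt_le hn fun v hv => ih v hv (hv.le.trans hw)
    obtain ⟨hwx, hwyz⟩ := le_inf_iff.1 hw
    rcases h w _ ((hcov _).2 rfl) (fun v => (hcov v).1) y z hwyz with hy | hz
    · exact hn (le_sup_of_le_left (le_inf hwx hy))
    · exact hn (le_sup_of_le_right (le_inf hwx hz))

/-- A finite lattice is distributive iff the join dependency relation
and its dual are both empty. -/
theorem distributive_iff_D_and_Dd_empty {α : Type*} [Lattice α] [Finite α] :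
    (∀ x y z : α, x ⊓ (y ⊔ z) = (x ⊓ y) ⊔ (x ⊓ z)) ↔
      (¬ ∃ j j' jstar j'star : α, j ≠ j' ∧
          jstar ⋖ j ∧ (∀ w : α, w ⋖ j → w = jstar) ∧
          j'star ⋖ j' ∧ (∀ w : α, w ⋖ j' → w = j'star) ∧
          ∀ θ : α → α → Prop, IsLatCong θ → θ j' j'star → θ j jstar) ∧
      (¬ ∃ m m' mstar m'star : α, m ≠ m' ∧
          m ⋖ mstar ∧ (∀ w : α, m ⋖ w → w = mstar) ∧
          m' ⋖ m'star ∧ (∀ w : α, m' ⋖ w → w = m'star) ∧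
          ∀ θ : α → α → Prop, IsLatCong θ → θ m' m'star → θ m mstar) := by
  constructor
  · intro h
    constructor
    · rintro ⟨j, j', s, s', hne, hsj, hs, hsj', hs', hdep⟩
      obtain ⟨θ, hθ, hcol, hsep⟩ := exists_isLatCong_separating h hne hsj hs hsj' hs'
      exact hsep (hdep θ hθ hcol)
    · rintro ⟨m, m', s, s', hne, hms, hs, hms', hs', hdep⟩
      let _ : DistribLattice α := DistribLattice.ofInfSupLe fun a b c => (h a b c).le
      obtain ⟨θ, hθ, hcol, hsep⟩ := exists_isLatCong_separating (α := αᵒᵈ)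
        (fun x y z => sup_inf_left x.ofDual y.ofDual z.ofDual)
        (j := OrderDual.toDual m) (j' := OrderDual.toDual m') hne
        hms.toDual (fun w hw => hs w.ofDual hw.ofDual)
        hms'.toDual (fun w hw => hs' w.ofDual hw.ofDual)
      exact hsep (hdep _ hθ.dual hcol)
  · rintro ⟨h, -⟩
    refine inf_sup_left_of_forall_le_or_le fun j s hsj hs a b =>
      le_or_le_of_le_sup_of_not_depends fun k t p hne htk ht hk => ?_
    by_contra hn
    exact h ⟨j, k, s, t, hne, hsj, hs, htk, ht, fun θ hθ hkt =>
      hθ.rel_of_le_sup hsj hs hkt hk hn⟩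
end

section
/- Let x, y, z be elements of a lattice L and define y_0 = y, z_0 = z, y_{n+1} = y ∨ (x ∧ z_n), z_{n+1} = z ∨ (x ∧ y_n). Then for all n, m ≥ 0: y_n ≤ y_{n+1}, z_n ≤ z_{n+1}, and y_n ∨ z_m = y ∨ z. -/
/-- The pair of sequences `(y_n, z_n)` with `y_0 = y`, `z_0 = z`,
`y_{n+1} = y ⊔ (x ⊓ z_n)`, `z_{n+1} = z ⊔ (x ⊓ y_n)`. -/
def yzSeq {α : Type*} [Lattice α] (x y z : α) : ℕ → α × α
  | 0 => (y, z)
  | n + 1 => (y ⊔ (x ⊓ (yzSeq x y z n).2), z ⊔ (x ⊓ (yzSeq x y z n).1))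

/-- The sequence `y_n`. -/
def ySeq {α : Type*} [Lattice α] (x y z : α) (n : ℕ) : α := (yzSeq x y z n).1

/-- The sequence `z_n`. -/
def zSeq {α : Type*} [Lattice α] (x y z : α) (n : ℕ) : α := (yzSeq x y z n).2

theorem yzSeq_monotone {α : Type*} [Lattice α] (x y z : α) : Monotone (yzSeq x y z) := by
  refine monotone_nat_of_le_succ fun n => ?_
  induction n with
  | zero => exact ⟨le_sup_left, le_sup_left⟩
  | succ n ih =>
    exact ⟨sup_le_sup_left (inf_le_inf_left x ih.2) y, sup_le_sup_left (inf_le_inf_left x ih.1) z⟩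

theorem yzSeq_le_sup {α : Type*} [Lattice α] (x y z : α) (n : ℕ) :
    yzSeq x y z n ≤ (y ⊔ z, y ⊔ z) := by
  induction n with
  | zero => exact ⟨le_sup_left, le_sup_right⟩
  | succ n ih =>
    exact ⟨sup_le le_sup_left (inf_le_right.trans ih.2),
      sup_le le_sup_right (inf_le_right.trans ih.1)⟩

/-- The sequences `y_n` and `z_n` are increasing, and
`y_n ⊔ z_m = y ⊔ z` for all `n, m ≥ 0`. -/
theorem ySeq_zSeq_monotone_and_join {α : Type*} [Lattice α] (x y z : α) :
    (∀ n : ℕ, ySeq x y z n ≤ ySeq x y z (n + 1)) ∧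
    (∀ n : ℕ, zSeq x y z n ≤ zSeq x y z (n + 1)) ∧
    (∀ n m : ℕ, ySeq x y z n ⊔ zSeq x y z m = y ⊔ z) := by
  refine ⟨fun n => (yzSeq_monotone x y z n.le_succ).1,
    fun n => (yzSeq_monotone x y z n.le_succ).2, fun n m => le_antisymm ?_ ?_⟩
  · exact sup_le (yzSeq_le_sup x y z n).1 (yzSeq_le_sup x y z m).2
  · exact sup_le_sup (yzSeq_monotone x y z n.zero_le).1 (yzSeq_monotone x y z m.zero_le).2
end

section
/- Let x, y, z be elements of a lattice L, let x̃ = x ∧ (y ∨ z), and let ỹ_n, z̃_n be the sequences defined from the triple (x̃, y, z) in the same way that y_n, z_n are defined from (x, y, z). Then for all n ≥ 0: ỹ_n = y_n, z̃_n = z_n, x ∧ y_n = x̃ ∧ y_n, and x ∧ z_n = x̃ ∧ z_n. -/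
theorem ySeq_zSeq_le_sup {α : Type*} [Lattice α] (x y z : α) (n : ℕ) :
    ySeq x y z n ≤ y ⊔ z ∧ zSeq x y z n ≤ y ⊔ z := by
  induction n with
  | zero => exact ⟨le_sup_left, le_sup_right⟩
  | succ n ih =>
    exact ⟨sup_le le_sup_left (inf_le_right.trans ih.2),
      sup_le le_sup_right (inf_le_right.trans ih.1)⟩

theorem inf_eq_inf_inf_of_le {α : Type*} [SemilatticeInf α] {a b : α} (x : α) (h : a ≤ b) :
    x ⊓ a = x ⊓ b ⊓ a := by
  rw [inf_assoc, inf_eq_right.mpr h]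

theorem yzSeq_inf_sup {α : Type*} [Lattice α] (x y z : α) (n : ℕ) :
    yzSeq (x ⊓ (y ⊔ z)) y z n = yzSeq x y z n := by
  induction n with
  | zero => rfl
  | succ n ih =>
    obtain ⟨hy, hz⟩ := ySeq_zSeq_le_sup x y z n
    simp only [yzSeq, ih]
    exact Prod.ext (congrArg (y ⊔ ·) (inf_eq_inf_inf_of_le x hz).symm)
      (congrArg (z ⊔ ·) (inf_eq_inf_inf_of_le x hy).symm)

/-- Replacing `x` by `x̃ = x ⊓ (y ⊔ z)` does not change the sequences,
nor the meets with `x`: `ỹ_n = y_n`, `z̃_n = z_n`, `x ⊓ y_n = x̃ ⊓ y_n`, and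
`x ⊓ z_n = x̃ ⊓ z_n`. -/
theorem seq_reduce_to_below_join {α : Type*} [Lattice α] (x y z : α) (n : ℕ) :
    ySeq (x ⊓ (y ⊔ z)) y z n = ySeq x y z n ∧
    zSeq (x ⊓ (y ⊔ z)) y z n = zSeq x y z n ∧
    x ⊓ ySeq x y z n = (x ⊓ (y ⊔ z)) ⊓ ySeq x y z n ∧
    x ⊓ zSeq x y z n = (x ⊓ (y ⊔ z)) ⊓ zSeq x y z n := by
  exact ⟨congrArg Prod.fst (yzSeq_inf_sup x y z n), congrArg Prod.snd (yzSeq_inf_sup x y z n),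
    inf_eq_inf_inf_of_le x (ySeq_zSeq_le_sup x y z n).1,
    inf_eq_inf_inf_of_le x (ySeq_zSeq_le_sup x y z n).2⟩
end

section
/- Let x, y, z be elements of a lattice L and, for k ≥ 1, let x_k = (x ∧ y_{k-1}) ∨ (x ∧ z_{k-1}). Then x ∧ y_{k-1} ≤ x_k ≤ x ∧ y_k ≤ y_k, and moreover y ∨ x_k = y_k, y_{k-1} ∨ x_k = y_{k-1} ∨ (x ∧ y_k) = y_k, and y_{k-1} ∧ x_k = y_{k-1} ∧ (x ∧ y_k) = x ∧ y_{k-1}; that is, the quotient (x ∧ y_k)/x_k together with y_{k-1} forms a possibly degenerate pentagon with bottom x ∧ y_{k-1} and top y_k. -/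
/-- For `k ≥ 1`, `x_k = (x ⊓ y_{k-1}) ⊔ (x ⊓ z_{k-1})`. -/
def xSeq {α : Type*} [Lattice α] (x y z : α) (k : ℕ) : α :=
  (x ⊓ ySeq x y z (k - 1)) ⊔ (x ⊓ zSeq x y z (k - 1))

theorem yzSeq_le_succ {α : Type*} [Lattice α] (x y z : α) (n : ℕ) :
    yzSeq x y z n ≤ yzSeq x y z (n + 1) := by
  induction n with
  | zero => exact ⟨le_sup_left, le_sup_left⟩
  | succ n ih =>
    exact ⟨sup_le_sup_left (inf_le_inf_left x ih.2) y, sup_le_sup_left (inf_le_inf_left x ih.1) z⟩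

theorem monotone_ySeq {α : Type*} [Lattice α] (x y z : α) : Monotone (ySeq x y z) :=
  monotone_nat_of_le_succ fun n => (yzSeq_le_succ x y z n).1

theorem ySeq_succ {α : Type*} [Lattice α] (x y z : α) (n : ℕ) :
    ySeq x y z (n + 1) = y ⊔ (x ⊓ zSeq x y z n) := rfl

/-- For `k ≥ 1`, `x ⊓ y_{k-1} ≤ x_k ≤ x ⊓ y_k ≤ y_k`, and
`(x ⊓ y_k)/x_k` together with `y_{k-1}` forms a (possibly degenerate) pentagon with
bottom `x ⊓ y_{k-1}` and top `y_k`: `y ⊔ x_k = y_k`, `y_{k-1} ⊔ x_k = y_{k-1} ⊔ (x ⊓ y_k) = y_k`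
and `y_{k-1} ⊓ x_k = y_{k-1} ⊓ (x ⊓ y_k) = x ⊓ y_{k-1}`. -/
theorem xSeq_pentagon {α : Type*} [Lattice α] (x y z : α) (k : ℕ) (hk : 1 ≤ k) :
    x ⊓ ySeq x y z (k - 1) ≤ xSeq x y z k ∧
    xSeq x y z k ≤ x ⊓ ySeq x y z k ∧
    x ⊓ ySeq x y z k ≤ ySeq x y z k ∧
    y ⊔ xSeq x y z k = ySeq x y z k ∧
    ySeq x y z (k - 1) ⊔ xSeq x y z k = ySeq x y z k ∧
    ySeq x y z (k - 1) ⊔ (x ⊓ ySeq x y z k) = ySeq x y z k ∧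
    ySeq x y z (k - 1) ⊓ xSeq x y z k = x ⊓ ySeq x y z (k - 1) ∧
    ySeq x y z (k - 1) ⊓ (x ⊓ ySeq x y z k) = x ⊓ ySeq x y z (k - 1) := by
  obtain ⟨n, rfl⟩ := Nat.exists_eq_add_of_le' hk
  simp only [Nat.add_sub_cancel]
  have hy : y ≤ ySeq x y z n := monotone_ySeq x y z n.zero_le
  have hmono : ySeq x y z n ≤ ySeq x y z (n + 1) := monotone_ySeq x y z n.le_succ
  have hz : x ⊓ zSeq x y z n ≤ ySeq x y z (n + 1) := le_sup_right
  have hlow : x ⊓ ySeq x y z n ≤ xSeq x y z (n + 1) := le_sup_left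
  have hupp : xSeq x y z (n + 1) ≤ x ⊓ ySeq x y z (n + 1) :=
    sup_le (inf_le_inf_left x hmono) (le_inf inf_le_left hz)
  have hle : xSeq x y z (n + 1) ≤ ySeq x y z (n + 1) := hupp.trans inf_le_right
  have hge : ySeq x y z (n + 1) ≤ y ⊔ xSeq x y z (n + 1) := by
    rw [ySeq_succ]
    exact sup_le_sup_left le_sup_right y
  have hge' : ySeq x y z (n + 1) ≤ ySeq x y z n ⊔ xSeq x y z (n + 1) :=
    hge.trans (sup_le_sup_right hy _)
  refine ⟨hlow, hupp, inf_le_right, ?_, ?_, ?_, ?_, ?_⟩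
  · exact (sup_le (hy.trans hmono) hle).antisymm hge
  · exact (sup_le hmono hle).antisymm hge'
  · exact (sup_le hmono inf_le_right).antisymm (hge'.trans (sup_le_sup_left hupp _))
  · exact (le_inf (inf_le_right.trans (hupp.trans inf_le_left)) inf_le_left).antisymm
      (le_inf inf_le_right hlow)
  · exact (le_inf (inf_le_right.trans inf_le_left) inf_le_left).antisymm
      (le_inf inf_le_right (hlow.trans hupp))
end

section
/- Let x, y, z be elements of a lattice L, let y_n, z_n, x_k be the associated sequences, and let k ≥ 2. If the pentagon Z_k = N((x ∧ z_k)/x_k, z_{k-1}) is nondegenerate (i.e. x_k < x ∧ z_k), then the pentagon Y_{k-1} = N((x ∧ y_{k-1})/x_{k-1}, y_{k-2}) is nondegenerate (i.e. x_{k-1} < x ∧ y_{k-1}). -/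
theorem ySeq_le_succ {α : Type*} [Lattice α] (x y z : α) (n : ℕ) :
    ySeq x y z n ≤ ySeq x y z (n + 1) :=
  (yzSeq_le_succ x y z n).1

theorem zSeq_le_succ {α : Type*} [Lattice α] (x y z : α) (n : ℕ) :
    zSeq x y z n ≤ zSeq x y z (n + 1) :=
  (yzSeq_le_succ x y z n).2

theorem xSeq_succ_le_inf_ySeq {α : Type*} [Lattice α] (x y z : α) (n : ℕ) :
    xSeq x y z (n + 1) ≤ x ⊓ ySeq x y z (n + 1) :=
  sup_le (inf_le_inf_left x (ySeq_le_succ x y z n)) (le_inf inf_le_left le_sup_right)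

/-- If `x ⊓ y_{n+1} = x_{n+1}`, then the sequence `z` is stationary from `n + 1` to `n + 2`. -/
theorem zSeq_add_two_le {α : Type*} [Lattice α] (x y z : α) (n : ℕ)
    (h : x ⊓ ySeq x y z (n + 1) ≤ xSeq x y z (n + 1)) :
    zSeq x y z (n + 2) ≤ zSeq x y z (n + 1) :=
  sup_le le_sup_left <| h.trans <|
    sup_le le_sup_right (inf_le_right.trans (zSeq_le_succ x y z n))

/-- For `k ≥ 2`, if the pentagon `Z_k = N((x ⊓ z_k)/x_k, z_{k-1})` is
nondegenerate, then the pentagon `Y_{k-1} = N((x ⊓ y_{k-1})/x_{k-1}, y_{k-2})` is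
nondegenerate. -/
theorem Zk_nondegenerate_implies_Yk_pred {α : Type*} [Lattice α]
    (x y z : α) (k : ℕ) (hk : 2 ≤ k)
    (hZ : xSeq x y z k < x ⊓ zSeq x y z k) :
    xSeq x y z (k - 1) < x ⊓ ySeq x y z (k - 1) := by
  obtain ⟨n, rfl⟩ := Nat.exists_eq_add_of_le' hk
  refine lt_of_le_not_ge (xSeq_succ_le_inf_ySeq x y z n) fun h => hZ.not_ge ?_
  exact (inf_le_inf_left x (zSeq_add_two_le x y z n h)).trans le_sup_right
end
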